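/- arXiv:0712.3231 — 5 statements merged into one kernel-verified Lean document; each statement's English description precedes it below -/
import Mathlib

section
/- Let Φ be a submultiplicative Orlicz function, let ξ and ζ be independent random variables with values in measurable spaces, let z be a measurable function with values in a normed space, and set Z = z(ξ, ζ). Define the partial Luxemburg norm in the ξ-variable as the function of the second argument g(w) = inf{ u > 0 : E_ξ[Φ(‖z(ξ, w)‖/u)] ≤ 1 }, where E_ξ denotes expectation with respect to the distribution of ξ. Then ‖Z‖_Φ ≤ ‖g(ζ)‖_Φ. -/
open MeasureTheory ProbabilityTheory Filter

/-- The Luxemburg norm `‖X‖_Φ = inf {u > 0 : E[Φ(‖X‖/u)] ≤ 1}` of a random variable `X`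
with values in a normed space, taking the value `∞` when no such `u` exists. -/
noncomputable def luxNorm {Ω : Type*} [MeasurableSpace Ω] {E : Type*} [NormedAddCommGroup E]
    (μ : Measure Ω) (Φ : ℝ → ℝ) (X : Ω → E) : ENNReal :=
  sInf {u : ENNReal | 0 < u ∧ u ≠ ⊤ ∧ ∫⁻ ω, ENNReal.ofReal (Φ (‖X ω‖ / u.toReal)) ∂μ ≤ 1}

/-- The Luxemburg norm of an `ℝ≥0∞`-valued random variable (it is `∞` unless the
variable is a.e. finite). -/
noncomputable def luxNormENN {Ω : Type*} [MeasurableSpace Ω]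
    (μ : Measure Ω) (Φ : ℝ → ℝ) (f : Ω → ENNReal) : ENNReal :=
  sInf {u : ENNReal | 0 < u ∧ u ≠ ⊤ ∧ (∀ᵐ ω ∂μ, f ω ≠ ⊤) ∧
    ∫⁻ ω, ENNReal.ofReal (Φ ((f ω).toReal / u.toReal)) ∂μ ≤ 1}

/-- An Orlicz function: convex, increasing on `[0,∞)` and vanishing at `0`. -/
def IsOrlicz (Φ : ℝ → ℝ) : Prop :=
  ConvexOn ℝ (Set.Ici 0) Φ ∧ MonotoneOn Φ (Set.Ici 0) ∧ Φ 0 = 0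

/-- Submultiplicativity: `Φ(xy) ≤ Φ(x)Φ(y)` for all `x, y ≥ 0`. -/
def Submult (Φ : ℝ → ℝ) : Prop :=
  ∀ x y : ℝ, 0 ≤ x → 0 ≤ y → Φ (x * y) ≤ Φ x * Φ y

theorem IsOrlicz.nonneg {Φ : ℝ → ℝ} (hΦ : IsOrlicz Φ) {x : ℝ} (hx : 0 ≤ x) : 0 ≤ Φ x := by
  simpa [hΦ.2.2] using hΦ.2.1 (Set.mem_Ici.2 le_rfl) (Set.mem_Ici.2 hx) hx

theorem IsOrlicz.measurable_comp {Φ : ℝ → ℝ} (hΦ : IsOrlicz Φ) {α : Type*} [MeasurableSpace α]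
    {f : α → ℝ} (hf : Measurable f) (hf0 : ∀ a, 0 ≤ f a) : Measurable fun a => Φ (f a) := by
  have hmono : Monotone fun x : ℝ => Φ (max 0 x) := fun x y hxy =>
    hΦ.2.1 (Set.mem_Ici.2 (le_max_left _ _)) (Set.mem_Ici.2 (le_max_left _ _))
      (max_le_max le_rfl hxy)
  simpa [Function.comp_def, hf0] using hmono.measurable.comp hf

/-- A bound by `Φ` at every point to the right of `x` persists at `x`. -/
theorem IsOrlicz.le_ofReal_of_forall_gt {Φ : ℝ → ℝ} (hΦ : IsOrlicz Φ) {x : ℝ} (hx : 0 ≤ x)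
    {a : ENNReal} (h : ∀ y, x < y → a ≤ ENNReal.ofReal (Φ y)) : a ≤ ENNReal.ofReal (Φ x) := by
  have hlim : Tendsto (fun s : ℝ => ENNReal.ofReal ((1 - s) * Φ x + s * Φ (x + 1)))
      (nhdsWithin 0 (Set.Ioi 0)) (nhds (ENNReal.ofReal (Φ x))) := by
    have hc : Continuous fun s : ℝ => ENNReal.ofReal ((1 - s) * Φ x + s * Φ (x + 1)) :=
      ENNReal.continuous_ofReal.comp (by fun_prop)
    simpa using (hc.tendsto 0).mono_left nhdsWithin_le_nhds
  refine ge_of_tendsto hlim ?_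
  filter_upwards [Ioo_mem_nhdsGT (zero_lt_one (α := ℝ))] with s hs
  refine (h (x + s) (by linarith [hs.1])).trans (ENNReal.ofReal_le_ofReal ?_)
  have hconv := hΦ.1.2 (Set.mem_Ici.2 hx) (Set.mem_Ici.2 (by linarith : (0 : ℝ) ≤ x + 1))
    (by linarith [hs.2] : (0 : ℝ) ≤ 1 - s) hs.1.le (by ring)
  simp only [smul_eq_mul] at hconv
  rwa [show (1 - s) * x + s * (x + 1) = x + s by ring] at hconv

/-- For submultiplicative `Φ`, the modulus at scale `u` is bounded by `Φ (‖X‖_Φ / u)`. -/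
theorem Submult.lintegral_le_luxNorm {Φ : ℝ → ℝ} (hsub : Submult Φ) (hΦ : IsOrlicz Φ)
    {A E : Type*} [MeasurableSpace A] [NormedAddCommGroup E] (ν : Measure A) (X : A → E)
    {u : ℝ} (hu : 0 < u) (hX : luxNorm ν Φ X ≠ ⊤) :
    ∫⁻ a, ENNReal.ofReal (Φ (‖X a‖ / u)) ∂ν ≤
      ENNReal.ofReal (Φ ((luxNorm ν Φ X).toReal / u)) := by
  refine hΦ.le_ofReal_of_forall_gt (by positivity) fun y hy => ?_
  have hlt : luxNorm ν Φ X < ENNReal.ofReal (y * u) :=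
    (ENNReal.lt_ofReal_iff_toReal_lt hX).2 ((div_lt_iff₀ hu).1 hy)
  obtain ⟨v, ⟨hv0, hvtop, hv⟩, hvy⟩ := sInf_lt_iff.1 hlt
  have hvpos : 0 < v.toReal := ENNReal.toReal_pos hv0.ne' hvtop
  have hvle : v.toReal / u ≤ y :=
    (div_le_iff₀ hu).2 ((ENNReal.lt_ofReal_iff_toReal_lt hvtop).1 hvy).le
  have hvu : 0 ≤ v.toReal / u := by positivity
  calc ∫⁻ a, ENNReal.ofReal (Φ (‖X a‖ / u)) ∂ν
      ≤ ∫⁻ a, ENNReal.ofReal (Φ (v.toReal / u)) * ENNReal.ofReal (Φ (‖X a‖ / v.toReal)) ∂ν := by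
        refine lintegral_mono fun a => ?_
        rw [← ENNReal.ofReal_mul (hΦ.nonneg hvu)]
        refine ENNReal.ofReal_le_ofReal ?_
        have := hsub (v.toReal / u) (‖X a‖ / v.toReal) hvu (by positivity)
        rwa [show v.toReal / u * (‖X a‖ / v.toReal) = ‖X a‖ / u by field_simp] at this
    _ = ENNReal.ofReal (Φ (v.toReal / u)) * ∫⁻ a, ENNReal.ofReal (Φ (‖X a‖ / v.toReal)) ∂ν :=
        lintegral_const_mul' _ _ ENNReal.ofReal_ne_top
    _ ≤ ENNReal.ofReal (Φ (v.toReal / u)) := mul_le_of_le_one_right' hv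
    _ ≤ ENNReal.ofReal (Φ y) := ENNReal.ofReal_le_ofReal
        (hΦ.2.1 (Set.mem_Ici.2 hvu) (Set.mem_Ici.2 (hvu.trans hvle)) hvle)

/-- if `ξ` and `ζ` are independent, `Z = z(ξ, ζ)`, and
`g(w) = ‖z(ξ, w)‖_{Φ,ξ}` is the partial Luxemburg norm in the `ξ`-variable (i.e. the
Luxemburg norm with respect to the distribution of `ξ`), then `‖Z‖_Φ ≤ ‖g(ζ)‖_Φ`. -/
theorem stmt8 {Ω A B E : Type*} [MeasurableSpace Ω] [MeasurableSpace A] [MeasurableSpace B]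
    [NormedAddCommGroup E] [MeasurableSpace E] [BorelSpace E]
    (μ : Measure Ω) [IsProbabilityMeasure μ]
    (Φ : ℝ → ℝ) (hΦ : IsOrlicz Φ) (hsub : Submult Φ)
    (ξ : Ω → A) (ζ : Ω → B) (hξ : Measurable ξ) (hζ : Measurable ζ)
    (hIndep : IndepFun ξ ζ μ)
    (z : A → B → E) (hz : Measurable (fun p : A × B => z p.1 p.2)) :
    luxNorm μ Φ (fun ω => z (ξ ω) (ζ ω)) ≤
      luxNormENN μ Φ (fun ω => luxNorm (Measure.map ξ μ) Φ (fun s => z s (ζ ω))) := by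
  refine le_sInf ?_
  rintro u ⟨hu0, hutop, hfin, hu⟩
  refine sInf_le ⟨hu0, hutop, ?_⟩
  have hupos : 0 < u.toReal := ENNReal.toReal_pos hu0.ne' hutop
  have hF : Measurable fun p : A × B => ENNReal.ofReal (Φ (‖z p.1 p.2‖ / u.toReal)) :=
    (hΦ.measurable_comp (hz.norm.div_const _) fun p => by positivity).ennreal_ofReal
  have := Measure.isProbabilityMeasure_map (μ := μ) hξ.aemeasurable
  have := Measure.isProbabilityMeasure_map (μ := μ) hζ.aemeasurable
  have hprod := (indepFun_iff_map_prod_eq_prod_map_map hξ.aemeasurable hζ.aemeasurable).1 hIndep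
  calc ∫⁻ ω, ENNReal.ofReal (Φ (‖z (ξ ω) (ζ ω)‖ / u.toReal)) ∂μ
      = ∫⁻ p, ENNReal.ofReal (Φ (‖z p.1 p.2‖ / u.toReal)) ∂(μ.map fun ω => (ξ ω, ζ ω)) :=
        (lintegral_map hF (hξ.prodMk hζ)).symm
    _ = ∫⁻ w, ∫⁻ s, ENNReal.ofReal (Φ (‖z s w‖ / u.toReal)) ∂(μ.map ξ) ∂(μ.map ζ) := by
        rw [hprod, lintegral_prod_symm' _ hF]
    _ = ∫⁻ ω, ∫⁻ s, ENNReal.ofReal (Φ (‖z s (ζ ω)‖ / u.toReal)) ∂(μ.map ξ) ∂μ :=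
        lintegral_map hF.lintegral_prod_left' hζ
    _ ≤ ∫⁻ ω, ENNReal.ofReal
          (Φ ((luxNorm (μ.map ξ) Φ fun s => z s (ζ ω)).toReal / u.toReal)) ∂μ := by
        refine lintegral_mono_ae ?_
        filter_upwards [hfin] with ω hω
        exact hsub.lintegral_le_luxNorm hΦ _ _ hupos hω
    _ ≤ 1 := hu
end

section
/- Let u_0 ≥ 0 and let (u_n)_{n∈ℤ} be a real sequence such that |u_n| ≤ u_0 for all n < 0. Let a_1, …, a_p be fixed nonnegative numbers with a = Σ_{i=1}^p a_i < 1, and assume u_n = Σ_{i=1}^p a_i u_{n−i} for all n ≥ 0. Then sup_{k ≥ n} u_k ≤ a^{n/p} u_0 for all n ≥ 0 (with the real power a^{n/p}). -/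
open Filter

/-- let `u₀ ≥ 0` and `(u_n)_{n∈ℤ}` be a real sequence with `|u_n| ≤ u₀`
for all `n < 0`, satisfying `u_n = Σ_{i=1}^p a_i u_{n-i}` for all `n ≥ 0`, where the
`a_i` are nonnegative with `a = Σ_{i=1}^p a_i < 1`.  Then `sup_{k≥n} u_k ≤ a^{n/p} u₀`
for all `n ≥ 0`, with the real power `a^{n/p}`. -/
theorem stmt10 (p : ℕ) (hp : 1 ≤ p) (a : ℕ → ℝ)
    (hann : ∀ i, 0 ≤ a i) (ha : ∑ i ∈ Finset.Icc 1 p, a i < 1)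
    (u : ℤ → ℝ) (u0 : ℝ) (hu0 : 0 ≤ u0)
    (hneg : ∀ n : ℤ, n < 0 → |u n| ≤ u0)
    (hrec : ∀ n : ℤ, 0 ≤ n → u n = ∑ i ∈ Finset.Icc 1 p, a i * u (n - i)) :
    ∀ n : ℕ, ∀ k : ℤ, (n : ℤ) ≤ k →
      u k ≤ (∑ i ∈ Finset.Icc 1 p, a i) ^ ((n : ℝ) / (p : ℝ)) * u0 := by
  intro n k hnk
  have hp0 : (0 : ℝ) < p := by exact_mod_cast hp
  have hA0 : 0 ≤ ∑ i ∈ Finset.Icc 1 p, a i := Finset.sum_nonneg fun i _ => hann i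
  rcases hA0.eq_or_lt with hA | hA
  · have hzero := (Finset.sum_eq_zero_iff_of_nonneg fun i _ => hann i).1 hA.symm
    have huk : u k = 0 := by
      rw [hrec k (by omega)]
      exact Finset.sum_eq_zero fun i hi => by rw [hzero i hi, zero_mul]
    rw [huk]
    positivity
  · generalize hS : ∑ i ∈ Finset.Icc 1 p, a i = A at *
    have key : ∀ m : ℕ, |u m| ≤ A ^ ((m : ℝ) / p) * u0 := by
      intro m
      induction m using Nat.strong_induction_on with
      | _ m ih =>
        have hterm : ∀ i ∈ Finset.Icc 1 p, |u (m - i)| ≤ A ^ ((m : ℝ) / p - 1) * u0 := by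
          intro i hi
          obtain ⟨hi1, hip⟩ := Finset.mem_Icc.1 hi
          have hip' : (i : ℝ) ≤ p := by exact_mod_cast hip
          rcases lt_or_ge m i with hmi | him
          · have hmp : (m : ℝ) ≤ p := by exact_mod_cast hmi.le.trans hip
            have hone : 1 ≤ A ^ ((m : ℝ) / p - 1) :=
              Real.one_le_rpow_of_pos_of_le_one_of_nonpos hA ha.le
                (sub_nonpos.2 ((div_le_one hp0).2 hmp))
            exact (hneg _ (by omega)).trans (le_mul_of_one_le_left hu0 hone)
          · have h := ih (m - i) (by omega)
            rw [Nat.cast_sub him, Nat.cast_sub him] at h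
            refine h.trans (mul_le_mul_of_nonneg_right ?_ hu0)
            refine Real.rpow_le_rpow_of_exponent_ge hA ha.le ?_
            rw [sub_div]
            linarith [(div_le_one hp0).2 hip']
        calc |u m| = |∑ i ∈ Finset.Icc 1 p, a i * u (m - i)| := by rw [hrec m (by omega)]
          _ ≤ ∑ i ∈ Finset.Icc 1 p, |a i * u (m - i)| := Finset.abs_sum_le_sum_abs _ _
          _ ≤ ∑ i ∈ Finset.Icc 1 p, a i * (A ^ ((m : ℝ) / p - 1) * u0) := by
            refine Finset.sum_le_sum fun i hi => ?_
            rw [abs_mul, abs_of_nonneg (hann i)]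
            exact mul_le_mul_of_nonneg_left (hterm i hi) (hann i)
          _ = A ^ ((m : ℝ) / p) * u0 := by
            rw [← Finset.sum_mul, hS, Real.rpow_sub_one hA.ne']
            field_simp
    lift k to ℕ using by omega
    have hnk' : (n : ℝ) ≤ k := by exact_mod_cast hnk
    refine (le_abs_self _).trans ((key k).trans (mul_le_mul_of_nonneg_right ?_ hu0))
    exact Real.rpow_le_rpow_of_exponent_ge hA ha.le (by gcongr)
end

section
/- Let 0 < a < 1 and let (a_j)_{j≥1} be nonnegative reals with a_j ≤ c e^{−β j} for all j ≥ 1, for some constants c > 0 and β > 0. Then there exists a constant C > 0 such that for every integer r ≥ 1, inf_{1 ≤ p ≤ r} ( a^{r/p} + (1/(1 − a)) Σ_{k ≥ p+1} a_k ) ≤ C exp( −√( (−ln a) β r ) ), where p ranges over integers and a^{r/p} is the real power. -/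
open Filter

/-- Some integer `p ∈ [1, r]` balances `L r / p` and `β (p + 1)`: both are at least
`√(L β r)` up to an additive constant. -/
theorem exists_nat_balancing {L β : ℝ} (hL : 0 < L) (hβ : 0 < β) {r : ℕ} (hr : 1 ≤ r) :
    ∃ p : ℕ, 1 ≤ p ∧ p ≤ r ∧ √(L * β * r) - β ≤ L * (r / p) ∧ √(L * β * r) - L ≤ β * (p + 1) := by
  have hr' : (1 : ℝ) ≤ r := by exact_mod_cast hr
  have hpos : 0 < L * β * r := by positivity
  have hs2 := Real.sq_sqrt hpos.le
  have hs := Real.sqrt_pos.2 hpos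
  set s := √(L * β * r)
  have hle : (⌊s / β⌋₊ : ℝ) * β ≤ s := (le_div_iff₀ hβ).1 (Nat.floor_le (by positivity))
  have hlt : s < (⌊s / β⌋₊ + 1 : ℝ) * β := (div_lt_iff₀ hβ).1 (Nat.lt_floor_add_one _)
  generalize ⌊s / β⌋₊ = q at hle hlt
  rcases Nat.eq_zero_or_pos q with rfl | hq
  · refine ⟨1, le_rfl, hr, ?_, ?_⟩
    · have : 0 < L * (r / (1 : ℕ)) := by positivity
      norm_num at hlt
      linarith
    · norm_num at hlt ⊢
      linarith
  · have hq' : (0 : ℝ) < q := by exact_mod_cast hq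
    rcases le_or_gt q r with hqr | hqr
    · refine ⟨q, hq, hqr, ?_, by linarith⟩
      have : s ≤ L * (r / q) := by
        rw [← mul_div_assoc, le_div_iff₀ hq']
        refine le_of_mul_le_mul_right ?_ hβ
        nlinarith
      linarith
    · have hqr' : (r : ℝ) < q := by exact_mod_cast hqr
      have hsL : s ≤ L := by
        refine le_of_mul_le_mul_right ?_ hs
        nlinarith [mul_le_mul_of_nonneg_right hqr'.le hβ.le]
      refine ⟨r, hr, le_rfl, ?_, ?_⟩
      · rw [div_self (by positivity)]
        linarith
      · have : 0 < β * ((r : ℝ) + 1) := by positivity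
        linarith

/-- The tail of a nonnegative sequence dominated by a geometric one. -/
theorem tsum_tail_le_of_le_exp {u : ℕ → ℝ} {c β : ℝ} (hu : ∀ j, 0 ≤ u j) (hβ : 0 < β)
    (h : ∀ j : ℕ, 1 ≤ j → u j ≤ c * Real.exp (-β * j)) (p : ℕ) :
    ∑' k : ℕ, u (p + 1 + k) ≤ c * (1 - Real.exp (-β))⁻¹ * Real.exp (-(β * (p + 1))) := by
  have hgeom : HasSum (fun k : ℕ => c * Real.exp (-(β * (p + 1))) * Real.exp (-β) ^ k)
      (c * Real.exp (-(β * (p + 1))) * (1 - Real.exp (-β))⁻¹) :=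
    (hasSum_geometric_of_lt_one (Real.exp_pos _).le
      (Real.exp_lt_one_iff.2 (by linarith))).mul_left _
  have hle : ∀ k : ℕ, u (p + 1 + k) ≤ c * Real.exp (-(β * (p + 1))) * Real.exp (-β) ^ k := by
    intro k
    refine (h (p + 1 + k) (by omega)).trans_eq ?_
    rw [← Real.exp_nat_mul, mul_assoc, ← Real.exp_add]
    push_cast
    ring_nf
  have hsum : Summable fun k : ℕ => u (p + 1 + k) :=
    Summable.of_nonneg_of_le (fun _ => hu _) hle hgeom.summable
  calc ∑' k : ℕ, u (p + 1 + k) ≤ _ := hasSum_le hle hsum.hasSum hgeom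
    _ = _ := by ring

/-- if `0 < a < 1` and the nonnegative coefficients satisfy
`a_j ≤ c e^{-βj}` for `j ≥ 1`, then there is `C > 0` such that for every `r ≥ 1`,
`inf_{1≤p≤r} (a^{r/p} + (1/(1-a)) Σ_{k≥p+1} a_k) ≤ C exp(-√((-ln a) β r))`. -/
theorem stmt14 (a : ℝ) (ha0 : 0 < a) (ha1 : a < 1)
    (aseq : ℕ → ℝ) (hnn : ∀ j, 0 ≤ aseq j)
    (c β : ℝ) (hc : 0 < c) (hβ : 0 < β)
    (hdecay : ∀ j : ℕ, 1 ≤ j → aseq j ≤ c * Real.exp (-β * (j : ℝ))) :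
    ∃ C : ℝ, 0 < C ∧ ∀ r : ℕ, 1 ≤ r →
      sInf {v : ℝ | ∃ p : ℕ, 1 ≤ p ∧ p ≤ r ∧
          v = a ^ ((r : ℝ) / (p : ℝ)) + (1 / (1 - a)) * ∑' k : ℕ, aseq (p + 1 + k)} ≤
        C * Real.exp (-Real.sqrt ((-Real.log a) * β * (r : ℝ))) := by
  have hL : 0 < -Real.log a := neg_pos.2 (Real.log_neg ha0 ha1)
  have ha : 0 < 1 / (1 - a) := one_div_pos.2 (sub_pos.2 ha1)
  have hE : 0 < (1 - Real.exp (-β))⁻¹ :=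
    inv_pos.2 (sub_pos.2 (Real.exp_lt_one_iff.2 (by linarith)))
  refine ⟨Real.exp β + 1 / (1 - a) * (c * (1 - Real.exp (-β))⁻¹ * Real.exp (-Real.log a)),
    by positivity, fun r hr => ?_⟩
  obtain ⟨p, hp1, hpr, hp, hp'⟩ := exists_nat_balancing hL hβ hr
  have hbdd : BddBelow {v : ℝ | ∃ p : ℕ, 1 ≤ p ∧ p ≤ r ∧
      v = a ^ ((r : ℝ) / (p : ℝ)) + (1 / (1 - a)) * ∑' k : ℕ, aseq (p + 1 + k)} := by
    refine ⟨0, ?_⟩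
    rintro v ⟨q, -, -, rfl⟩
    exact add_nonneg (Real.rpow_nonneg ha0.le _) (mul_nonneg ha.le (tsum_nonneg fun _ => hnn _))
  refine (csInf_le hbdd ⟨p, hp1, hpr, rfl⟩).trans ?_
  set s := Real.sqrt (-Real.log a * β * r)
  rw [add_mul, mul_assoc (1 / (1 - a)), mul_assoc (c * _), ← Real.exp_add, ← Real.exp_add,
    Real.rpow_def_of_pos ha0]
  gcongr ?_ + _ * ?_
  · exact Real.exp_le_exp.2 (by linarith)
  · refine (tsum_tail_le_of_le_exp hnn hβ hdecay p).trans ?_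
    gcongr
    linarith
end

section
/- Let 0 < a < 1 and let (a_j)_{j≥1} be nonnegative reals with a_j ≤ c j^{−β} for all j ≥ 1, for some constants c > 0 and β > 1. Then there exists a constant C > 0 such that for every integer r ≥ 2, inf_{1 ≤ p ≤ r} ( a^{r/p} + (1/(1 − a)) Σ_{k ≥ p+1} a_k ) ≤ C ( (ln r)/r )^{β−1}, where p ranges over integers and a^{r/p} is the real power. -/
open Filter

/-- The telescoping estimate behind the comparison of `∑ j ^ (-(s + 1))` with an integral. -/
lemma mul_rpow_neg_add_one_le_sub {s x : ℝ} (hs : 0 < s) (hx : 0 < x) :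
    s * (x + 1) ^ (-(s + 1)) ≤ x ^ (-s) - (x + 1) ^ (-s) := by
  have hx1 : 0 < x + 1 := by linarith
  have hlog : Real.log (x / (x + 1)) ≤ -(1 / (x + 1)) := by
    refine (Real.log_le_sub_one_of_pos (by positivity)).trans_eq ?_
    field_simp
    ring
  have hratio : 1 + s / (x + 1) ≤ (x / (x + 1)) ^ (-s) := by
    rw [Real.rpow_def_of_pos (by positivity)]
    have h := Real.add_one_le_exp (Real.log (x / (x + 1)) * -s)
    have h2 := mul_le_mul_of_nonneg_left hlog hs.le
    have h3 : s * -(1 / (x + 1)) = -(s / (x + 1)) := by ring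
    linarith
  rw [Real.div_rpow hx.le hx1.le, le_div_iff₀ (by positivity)] at hratio
  have hsplit : (x + 1) ^ (-(s + 1)) = (x + 1) ^ (-s) / (x + 1) := by
    rw [neg_add, ← sub_eq_add_neg, Real.rpow_sub_one hx1.ne']
  rw [hsplit]
  have h4 : (1 + s / (x + 1)) * (x + 1) ^ (-s)
      = (x + 1) ^ (-s) + s * ((x + 1) ^ (-s) / (x + 1)) := by ring
  linarith

lemma tsum_tail_le_of_le_rpow {u : ℕ → ℝ} (hu : ∀ j, 0 ≤ u j) {c s : ℝ} (hc : 0 ≤ c)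
    (hs : 0 < s) (hdecay : ∀ j : ℕ, 1 ≤ j → u j ≤ c * (j : ℝ) ^ (-(s + 1)))
    {p : ℕ} (hp : 1 ≤ p) :
    ∑' k : ℕ, u (p + 1 + k) ≤ c / s * (p : ℝ) ^ (-s) := by
  refine Real.tsum_le_of_sum_range_le (fun _ => hu _) fun n => ?_
  have hp0 : (0 : ℝ) < p := by exact_mod_cast hp
  have key : ∑ k ∈ Finset.range n, u (p + 1 + k)
      ≤ c / s * ((p : ℝ) ^ (-s) - ((p + n : ℕ) : ℝ) ^ (-s)) := by
    induction n with
    | zero => simp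
    | succ n ih =>
      rw [Finset.sum_range_succ]
      have h1 := hdecay (p + 1 + n) (by omega)
      have h2 := mul_rpow_neg_add_one_le_sub (x := ((p + n : ℕ) : ℝ)) hs (by positivity)
      have h3 : ((p + 1 + n : ℕ) : ℝ) = ((p + n : ℕ) : ℝ) + 1 := by push_cast; ring
      have h4 : ((p + (n + 1) : ℕ) : ℝ) = ((p + n : ℕ) : ℝ) + 1 := by push_cast; ring
      rw [h3] at h1
      rw [h4]
      have h5 := mul_le_mul_of_nonneg_left h2 (div_nonneg hc hs.le)
      rw [← mul_assoc, div_mul_cancel₀ _ hs.ne'] at h5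
      linarith
  refine key.trans (mul_le_mul_of_nonneg_left ?_ (div_nonneg hc hs.le))
  have : (0 : ℝ) ≤ ((p + n : ℕ) : ℝ) ^ (-s) := by positivity
  linarith

/-- if `0 < a < 1` and the nonnegative coefficients satisfy
`a_j ≤ c j^{-β}` for `j ≥ 1` with `β > 1`, then there is `C > 0` such that for every
`r ≥ 2`, `inf_{1≤p≤r} (a^{r/p} + (1/(1-a)) Σ_{k≥p+1} a_k) ≤ C ((ln r)/r)^{β-1}`. -/
theorem stmt15 (a : ℝ) (ha0 : 0 < a) (ha1 : a < 1)
    (aseq : ℕ → ℝ) (hnn : ∀ j, 0 ≤ aseq j)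
    (c β : ℝ) (hc : 0 < c) (hβ : 1 < β)
    (hdecay : ∀ j : ℕ, 1 ≤ j → aseq j ≤ c * (j : ℝ) ^ (-β)) :
    ∃ C : ℝ, 0 < C ∧ ∀ r : ℕ, 2 ≤ r →
      sInf {v : ℝ | ∃ p : ℕ, 1 ≤ p ∧ p ≤ r ∧
          v = a ^ ((r : ℝ) / (p : ℝ)) + (1 / (1 - a)) * ∑' k : ℕ, aseq (p + 1 + k)} ≤
        C * (Real.log (r : ℝ) / (r : ℝ)) ^ (β - 1) := by
  obtain ⟨s, hs, rfl⟩ : ∃ s : ℝ, 0 < s ∧ β = s + 1 := ⟨β - 1, by linarith, by ring⟩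
  rw [add_sub_cancel_right]
  have hloga : Real.log a < 0 := Real.log_neg ha0 ha1
  have h1a : 0 < 1 - a := by linarith
  obtain ⟨κ, hκ, hκs, hκ2⟩ : ∃ κ : ℝ, 0 < κ ∧ κ * s ≤ -Real.log a ∧ κ ≤ Real.log 2 := by
    refine ⟨min (-Real.log a / s) (Real.log 2),
      lt_min (div_pos (by linarith) hs) (Real.log_pos one_lt_two), ?_, min_le_right _ _⟩
    rw [← le_div_iff₀ hs]
    exact min_le_left _ _
  refine ⟨(1 / κ) ^ s + 1 / (1 - a) * (c / s * (2 / κ) ^ s), by positivity, fun r hr => ?_⟩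
  have hr2 : (2 : ℝ) ≤ r := by exact_mod_cast hr
  have hr0 : (0 : ℝ) < r := by linarith
  have hκr : κ ≤ Real.log r := hκ2.trans (Real.log_le_log two_pos hr2)
  have hl : 0 < Real.log r := hκ.trans_le hκr
  set x : ℝ := κ * r / Real.log r with hx
  have hx0 : 0 < x := by positivity
  have hxr : x ≤ r := by
    rw [hx, div_le_iff₀ hl, mul_comm]
    exact mul_le_mul_of_nonneg_left hκr hr0.le
  have hxinv : Real.log r / r = κ / x := by
    rw [hx]
    field_simp
  set p : ℕ := max 1 ⌊x⌋₊ with hp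
  have hp1 : 1 ≤ p := le_max_left _ _
  have hpr : p ≤ r := max_le (by omega) (Nat.floor_le_of_le hxr)
  have hp1' : (1 : ℝ) ≤ p := by exact_mod_cast hp1
  have hp0 : (0 : ℝ) < p := by linarith
  have hxp : x / 2 ≤ p := by
    have h1 := Nat.lt_floor_add_one x
    have h2 : (⌊x⌋₊ : ℝ) ≤ p := by exact_mod_cast le_max_right 1 ⌊x⌋₊
    linarith
  have hfirst : a ^ ((r : ℝ) / p) ≤ (1 / κ) ^ s * (Real.log r / r) ^ s := by
    rw [← Real.mul_rpow (by positivity) (by positivity)]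
    rcases lt_or_ge x 1 with hx1 | hx1
    · refine (Real.rpow_le_one ha0.le ha1.le (by positivity)).trans
        (Real.one_le_rpow ?_ hs.le)
      rw [hxinv, one_div, inv_mul_eq_div, div_div_cancel_left' hκ.ne']
      exact (one_le_inv₀ hx0).2 hx1.le
    · have hpx : (p : ℝ) ≤ x := by
        rw [hp, max_eq_right ((Nat.one_le_floor_iff x).2 hx1)]
        exact Nat.floor_le hx0.le
      have hexp : Real.log a * (r / p) ≤ Real.log (r : ℝ)⁻¹ * s := by
        have h1 : Real.log r * p ≤ κ * r := by
          rwa [hx, le_div_iff₀ hl, mul_comm] at hpx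
        have h2 : Real.log r * s * p ≤ -Real.log a * r := by
          nlinarith [mul_le_mul_of_nonneg_left h1 hs.le,
            mul_le_mul_of_nonneg_right hκs hr0.le]
        have h3 : Real.log r * s ≤ -Real.log a * r / p := (le_div_iff₀ hp0).2 h2
        rw [Real.log_inv]
        have h4 : Real.log a * (r / p) = -(-Real.log a * r / p) := by ring
        linarith
      calc a ^ ((r : ℝ) / p) ≤ ((r : ℝ)⁻¹) ^ s := by
            rw [Real.rpow_def_of_pos ha0, Real.rpow_def_of_pos (inv_pos.2 hr0)]
            exact Real.exp_le_exp.2 hexp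
        _ ≤ (1 / κ * (Real.log r / r)) ^ s := by
            refine Real.rpow_le_rpow (by positivity) ?_ hs.le
            have h5 : 1 / κ * (Real.log r / r) = Real.log r / κ * (r : ℝ)⁻¹ := by ring
            rw [h5]
            exact le_mul_of_one_le_left (by positivity) ((one_le_div hκ).2 hκr)
  have htail : (p : ℝ) ^ (-s) ≤ (2 / κ) ^ s * (Real.log r / r) ^ s := by
    rw [← Real.mul_rpow (by positivity) (by positivity), Real.rpow_neg hp0.le,
      ← Real.inv_rpow hp0.le]
    refine Real.rpow_le_rpow (by positivity) ?_ hs.le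
    have h6 : 2 / κ * (Real.log r / r) = (x / 2)⁻¹ := by
      rw [hxinv]
      field_simp
    rw [h6]
    exact inv_anti₀ (by positivity) hxp
  have hsum := tsum_tail_le_of_le_rpow hnn hc.le hs hdecay hp1
  refine le_trans (csInf_le ⟨0, ?_⟩ ⟨p, hp1, hpr, rfl⟩) ?_
  · rintro v ⟨q, -, -, rfl⟩
    have : 0 ≤ ∑' k : ℕ, aseq (q + 1 + k) := tsum_nonneg fun _ => hnn _
    positivity
  · calc a ^ ((r : ℝ) / p) + 1 / (1 - a) * ∑' k : ℕ, aseq (p + 1 + k)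
        ≤ (1 / κ) ^ s * (Real.log r / r) ^ s
          + 1 / (1 - a) * (c / s * ((2 / κ) ^ s * (Real.log r / r) ^ s)) := by
          gcongr
          exact hsum.trans (mul_le_mul_of_nonneg_left htail (by positivity))
      _ = _ := by ring
end

section
/- Let q > 1, b ≥ 0 and Φ(x) = x^q (1 + ln(1 + x))^{(1+b)(q−1)}. Then for all x ≥ 0, Φ̃_q(x) ≤ exp( (q−1) x^{1/(1+b)} ) · x^{q−1}. -/
open Filter

/-- The transform `Φ̃_q(x) = sup_{y>0} {(xy)^{q-1} − Φ(y)/y}`. -/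
noncomputable def phiTilde (Φ : ℝ → ℝ) (q : ℝ) (x : ℝ) : ℝ :=
  sSup {z : ℝ | ∃ y : ℝ, 0 < y ∧ z = (x * y) ^ (q - 1) - Φ y / y}

/-- for `q > 1`, `b ≥ 0` and `Φ(x) = x^q (1 + ln(1+x))^{(1+b)(q-1)}`,
one has `Φ̃_q(x) ≤ exp((q-1) x^{1/(1+b)}) x^{q-1}` for all `x ≥ 0`. -/
theorem stmt17 (q b : ℝ) (hq : 1 < q) (hb : 0 ≤ b) (x : ℝ) (hx : 0 ≤ x) :
    phiTilde (fun t => t ^ q * (1 + Real.log (1 + t)) ^ ((1 + b) * (q - 1))) q x ≤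
      Real.exp ((q - 1) * x ^ (1 / (1 + b))) * x ^ (q - 1) := by
  have hq' : 0 ≤ q - 1 := by linarith
  have hb' : 0 < 1 + b := by linarith
  refine Real.sSup_le ?_ (by positivity)
  rintro z ⟨y, hy, rfl⟩
  have hlog : 0 ≤ Real.log (1 + y) := Real.log_nonneg (by linarith)
  have hL : 0 ≤ 1 + Real.log (1 + y) := by linarith
  have hdiv : y ^ q * (1 + Real.log (1 + y)) ^ ((1 + b) * (q - 1)) / y =
      y ^ (q - 1) * ((1 + Real.log (1 + y)) ^ (1 + b)) ^ (q - 1) := by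
    rw [Real.rpow_sub_one hy.ne', Real.rpow_mul hL]
    ring
  beta_reduce
  rw [hdiv, Real.mul_rpow hx hy.le]
  have hyq : 0 ≤ y ^ (q - 1) := by positivity
  rcases le_total x ((1 + Real.log (1 + y)) ^ (1 + b)) with h | h
  · have hpow := mul_le_mul_of_nonneg_left (Real.rpow_le_rpow hx h hq') hyq
    have hbound : 0 ≤ Real.exp ((q - 1) * x ^ (1 / (1 + b))) * x ^ (q - 1) := by positivity
    linarith
  · have hroot : 1 + Real.log (1 + y) ≤ x ^ (1 / (1 + b)) := by
      rw [one_div]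
      exact (Real.le_rpow_inv_iff_of_pos hL hx hb').2 h
    have hlogy : Real.log y ≤ x ^ (1 / (1 + b)) := by
      have := Real.log_le_log hy (show y ≤ 1 + y by linarith)
      linarith
    have hexp : y ^ (q - 1) ≤ Real.exp ((q - 1) * x ^ (1 / (1 + b))) := by
      rw [Real.rpow_def_of_pos hy, mul_comm]
      gcongr
    have hprod := mul_le_mul_of_nonneg_right hexp (Real.rpow_nonneg hx (q - 1))
    have hnonneg : 0 ≤ y ^ (q - 1) * ((1 + Real.log (1 + y)) ^ (1 + b)) ^ (q - 1) := by
      positivity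
    linarith
end
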